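/- There exist universal constants c, C > 0 such that the following holds. Let d ≥ 2, σ ∈ (0,1], K ≥ 1.5·d², set L = ⌈C·log²(dK)⌉, and assume L divides both d and K with K/L ≥ 1.5·(d/L)². Consider the combined instance consisting of L independent, orthogonally embedded hypercube instances of dimension d' = d/L, horizon K' = K/L and variance level σ (with weight vectors μ_1,…,μ_L drawn independently and uniformly from {−Δ',Δ'}^{d'}, Δ' = 1/√(96·K')), where in round k the learner is presented the decision set of instance ((k−1) mod L) + 1. Then for every deterministic algorithm, with probability at least 1 − 1/K³ (over the draws of μ_1,…,μ_L and the rewards), the total pseudo-regret satisfies Regret(K) ≥ c·d·√(K·σ²)/log³(dK). -/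

import Mathlib

open Finset

namespace CombinedHypercube

/-- An element of the hypercube `{−1,1}^{d'}`, encoded by its sign pattern. -/
abbrev Act (d' : ℕ) := Fin d' → Bool

/-- The real vector in `{−1,1}^{d'}` encoded by a sign pattern. -/
noncomputable def embed {d' : ℕ} (a : Act d') : Fin d' → ℝ := fun i => if a i then 1 else -1

/-- The weight vector in `{−Δ,Δ}^{d'}` encoded by a sign pattern. -/
noncomputable def wvec {d' : ℕ} (Δ : ℝ) (μ : Act d') : Fin d' → ℝ :=
  fun i => if μ i then Δ else -Δ

/-- The standard inner product on `ℝ^{d'}`. -/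
noncomputable def ip {d' : ℕ} (v w : Fin d' → ℝ) : ℝ := ∑ i, v i * w i

/-- A deterministic algorithm: a map choosing, from the history of past
(action, reward) pairs, the next action.  In round `k` the presented decision
set is the (orthogonally embedded) hypercube of instance `k mod L`, so an
action is described by its (nonzero) block, an element of `{−1,1}^{d'}`. -/
def Alg (d' : ℕ) := List ((Fin d' → ℝ) × ℝ) → Act d'

/-- The history of (action, reward) pairs after `k` rounds, given the Bernoulli
outcomes `ω`: in round `k` the reward is `σ · B` with `B = ω k ∈ {0,1}`. -/
noncomputable def hist {d' : ℕ} (π : Alg d') (σ : ℝ) (ω : ℕ → Bool) :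
    ℕ → List ((Fin d' → ℝ) × ℝ)
  | 0 => []
  | k + 1 =>
      hist π σ ω k ++ [(embed (π (hist π σ ω k)), σ * (if ω k then 1 else 0))]

/-- The action selected by the algorithm in round `k`. -/
noncomputable def act {d' : ℕ} (π : Alg d') (σ : ℝ) (ω : ℕ → Bool) (k : ℕ) : Act d' :=
  π (hist π σ ω k)

/-- The Bernoulli success probability of action `a`: `1/3 + ⟨μ, a⟩`. -/
noncomputable def bp {d' : ℕ} (Δ : ℝ) (μ a : Act d') : ℝ :=
  1 / 3 + ip (wvec Δ μ) (embed a)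

/-- Extension of a finite outcome sequence to `ℕ`. -/
def ext {K : ℕ} (ω : Fin K → Bool) : ℕ → Bool :=
  fun j => if h : j < K then ω ⟨j, h⟩ else false

/-- The weight vector of the instance active in round `k`, namely instance
`k mod L` (i.e. `((k−1) mod L) + 1` with one-based indexing). -/
def getμ {d' L : ℕ} (μ : Fin L → Act d') (k : ℕ) : Act d' :=
  if h : 0 < L then μ ⟨k % L, Nat.mod_lt _ h⟩ else fun _ => false

/-- The probability of the trajectory determined by the Bernoulli outcomes `ω`:
in round `k` the reward is governed by the weight vector of instance `k mod L`. -/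
noncomputable def trajP (d' L K : ℕ) (Δ σ : ℝ) (π : Alg d') (μ : Fin L → Act d')
    (ω : Fin K → Bool) : ℝ :=
  ∏ k : Fin K,
    (if ω k then bp Δ (getμ μ (k : ℕ)) (act π σ (ext ω) k)
     else 1 - bp Δ (getμ μ (k : ℕ)) (act π σ (ext ω) k))

/-- The maximal mean `max_{a ∈ {−1,1}^{d'}} ⟨μ, a⟩` over the decision set
presented in a round of instance `μ` (orthogonal embedding: only the active
block contributes to the inner product with the concatenated weight vector). -/
noncomputable def maxRew (d' : ℕ) (Δ : ℝ) (μ : Act d') : ℝ :=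
  Finset.univ.sup' Finset.univ_nonempty (fun a : Act d' => ip (wvec Δ μ) (embed a))

/-- The total pseudo-regret over all `K` rounds of the combined instance. -/
noncomputable def regret (d' L K : ℕ) (Δ σ : ℝ) (π : Alg d') (μ : Fin L → Act d')
    (ω : Fin K → Bool) : ℝ :=
  ∑ k : Fin K,
    σ * (maxRew d' Δ (getμ μ (k : ℕ)) -
      ip (wvec Δ (getμ μ (k : ℕ))) (embed (act π σ (ext ω) k)))

/-- The probability (over the independent uniform draws of `μ_1, …, μ_L` and the
rewards) that the total pseudo-regret is at least `t`. -/
noncomputable def probRegretGe (d' L K : ℕ) (Δ σ t : ℝ) (π : Alg d') : ℝ :=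
  (1 / 2 ^ (d' * L)) * ∑ μ : Fin L → Act d', ∑ ω : Fin K → Bool,
    (if t ≤ regret d' L K Δ σ π μ ω then trajP d' L K Δ σ π μ ω else 0)

/-! ### Single-instance analysis -/

/-- Likelihood of a (reversed) history of one instance. -/
noncomputable def lik {D : ℕ} (Δ : ℝ) (μ : Act D) : List (Act D × Bool) → ℝ
  | [] => 1
  | x :: h => (if x.2 then bp Δ μ x.1 else 1 - bp Δ μ x.1) * lik Δ μ h

/-- Number of mismatches in coordinate `i`. -/
noncomputable def mis {D : ℕ} (μ : Act D) (i : Fin D) : List (Act D × Bool) → ℝ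
  | [] => 0
  | x :: h => (if x.1 i = μ i then 0 else 1) + mis μ i h

noncomputable def misT {D : ℕ} (μ : Act D) (h : List (Act D × Bool)) : ℝ := ∑ i, mis μ i h

/-- Evaluation of a strategy tree. -/
noncomputable def W {D : ℕ} (s : ℕ → List (Act D × Bool) → Act D) :
    ℕ → (List (Act D × Bool) → ℝ) → List (Act D × Bool) → ℝ
  | 0, f, h => f h
  | n + 1, f, h => W s n f ((s n h, true) :: h) + W s n f ((s n h, false) :: h)

/-- Optimal value of the tree. -/
noncomputable def V {D : ℕ} :
    ℕ → (List (Act D × Bool) → ℝ) → List (Act D × Bool) → ℝ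
  | 0, f, h => f h
  | n + 1, f, h => Finset.univ.sup' Finset.univ_nonempty
      (fun a : Act D => V n f ((a, true) :: h) + V n f ((a, false) :: h))

lemma exists_strategy {D : ℕ} (g : List (Act D × Bool) → ℝ) :
    ∃ s, ∀ n h, W s n g h = V n g h := by
  have key : ∀ n h, ∃ a : Act D, V (n+1) g h = V n g ((a, true) :: h) + V n g ((a, false) :: h) := by
    intro n h
    obtain ⟨a, -, ha⟩ := Finset.exists_mem_eq_sup' (Finset.univ_nonempty)
      (fun a : Act D => V n g ((a, true) :: h) + V n g ((a, false) :: h))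
    exact ⟨a, ha⟩
  choose s hs using key
  refine ⟨s, fun n => ?_⟩
  induction n with
  | zero => intro h; rfl
  | succ n ih => intro h; rw [hs, W, ih, ih]

lemma V_step {D : ℕ} (g : List (Act D × Bool) → ℝ) (n h) (a : Act D) :
    V n g ((a, true) :: h) + V n g ((a, false) :: h) ≤ V (n+1) g h := by
  rw [V]
  exact Finset.le_sup' (fun a : Act D => V n g ((a, true) :: h) + V n g ((a, false) :: h))
    (Finset.mem_univ a)

lemma V_nonneg {D : ℕ} (g : List (Act D × Bool) → ℝ) (hg : ∀ h, 0 ≤ g h) (n h) :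
    0 ≤ V n g h := by
  induction n generalizing h with
  | zero => exact hg h
  | succ n ih =>
    exact le_trans (add_nonneg (ih _) (ih _)) (V_step g n h (fun _ => true))

lemma W_mono {D : ℕ} (s) (n : ℕ) (f g : List (Act D × Bool) → ℝ) (h)
    (hfg : ∀ h' : List (Act D × Bool), h'.length = n + h.length → f h' ≤ g h') :
    W s n f h ≤ W s n g h := by
  induction n generalizing h with
  | zero => exact hfg h (by simp)
  | succ n ih =>
    rw [W, W]
    refine add_le_add (ih _ ?_) (ih _ ?_) <;>
    · intro h' hh; apply hfg; rw [hh]; simp; ring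

lemma W_add {D : ℕ} (s) (n : ℕ) (f g : List (Act D × Bool) → ℝ) (h) :
    W s n (fun h => f h + g h) h = W s n f h + W s n g h := by
  induction n generalizing h with
  | zero => rfl
  | succ n ih => simp only [W, ih]; ring

lemma W_smul {D : ℕ} (s) (n : ℕ) (c : ℝ) (f : List (Act D × Bool) → ℝ) (h) :
    W s n (fun h => c * f h) h = c * W s n f h := by
  induction n generalizing h with
  | zero => rfl
  | succ n ih => simp only [W, ih]; ring

lemma W_sum {D : ℕ} {ι : Type*} (t : Finset ι) (s) (n : ℕ)
    (f : ι → List (Act D × Bool) → ℝ) (h) :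
    W s n (fun h => ∑ i ∈ t, f i h) h = ∑ i ∈ t, W s n (f i) h := by
  induction n generalizing h with
  | zero => rfl
  | succ n ih => simp only [W, ih, Finset.sum_add_distrib]

lemma abs_ip_le {D : ℕ} {Δ : ℝ} (hΔ : 0 ≤ Δ) (μ a : Act D) :
    |ip (wvec Δ μ) (embed a)| ≤ D * Δ := by
  unfold ip
  refine (Finset.abs_sum_le_sum_abs _ _).trans ?_
  have : ∀ i ∈ (Finset.univ : Finset (Fin D)), |wvec Δ μ i * embed a i| ≤ Δ := by
    intro i _
    unfold wvec embed
    split_ifs <;> simp [abs_of_nonneg hΔ]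
  refine (Finset.sum_le_sum this).trans ?_
  simp

lemma bp_bounds {D : ℕ} {Δ : ℝ} (hΔ : 0 ≤ Δ) (hD : D * Δ ≤ 1/12) (μ a : Act D) :
    1/4 ≤ bp Δ μ a ∧ bp Δ μ a ≤ 5/12 := by
  have := abs_le.mp (abs_ip_le hΔ μ a)
  unfold bp
  constructor <;> linarith [this.1, this.2]

lemma lik_nonneg {D : ℕ} {Δ : ℝ} (hΔ : 0 ≤ Δ) (hD : D * Δ ≤ 1/12) (μ : Act D) (h) :
    0 ≤ lik Δ μ h := by
  induction h with
  | nil => simp [lik]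
  | cons x h ih =>
    have := bp_bounds hΔ hD μ x.1
    rw [lik]
    apply mul_nonneg _ ih
    split_ifs <;> linarith [this.1, this.2]

/-- Flip a coordinate. -/
def flip {D : ℕ} (i : Fin D) (μ : Act D) : Act D := Function.update μ i (!μ i)

lemma flip_flip {D : ℕ} (i : Fin D) (μ : Act D) : flip i (flip i μ) = μ := by
  unfold flip; simp

lemma bp_flip {D : ℕ} {Δ : ℝ} (i : Fin D) (μ a : Act D) :
    (bp Δ μ a - bp Δ (flip i μ) a)^2 = 4 * Δ^2 := by
  have : bp Δ μ a - bp Δ (flip i μ) a = 2 * (wvec Δ μ i * embed a i) := by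
    unfold bp ip
    rw [add_sub_add_left_eq_sub, ← Finset.sum_sub_distrib, Finset.sum_eq_single i]
    · unfold wvec flip
      cases h : μ i <;> simp <;> ring
    · intro j _ hj
      unfold wvec flip
      simp [hj]
    · simp
  rw [this]
  unfold wvec embed
  split_ifs <;> ring

lemma sqrt_aux {p q : ℝ} (hp : 1/4 ≤ p) (hq : 1/4 ≤ q) (hp1 : p ≤ 1) (hq1 : q ≤ 1) :
    (p+q)/2 - (p-q)^2/2 ≤ √(p*q) := by
  apply Real.le_sqrt_of_sq_le
  have h1 : (p-q)^2 ≤ 2*p+2*q-1 := by nlinarith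
  nlinarith [mul_nonneg (sq_nonneg (p-q)) (sub_nonneg.2 h1)]

lemma W_lik {D : ℕ} {Δ : ℝ} (s) (μ : Act D) (n h) : W s n (lik Δ μ) h = lik Δ μ h := by
  induction n generalizing h with
  | zero => rfl
  | succ n ih => simp only [W, ih, lik]; simp; ring

lemma W_aff {D : ℕ} {Δ : ℝ} (hΔ : 0 ≤ Δ) (hD : D * Δ ≤ 1/12) (h4 : 4 * Δ^2 ≤ 1)
    (s) (i : Fin D) (μ : Act D) (n h) :
    (1 - 4 * Δ^2)^n * √(lik Δ μ h * lik Δ (flip i μ) h) ≤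
      W s n (fun h => √(lik Δ μ h * lik Δ (flip i μ) h)) h := by
  induction n generalizing h with
  | zero => simp [W]
  | succ n ih =>
    rw [W]
    refine le_trans ?_ (add_le_add (ih _) (ih _))
    obtain ⟨p1, p2⟩ := bp_bounds hΔ hD μ (s n h)
    obtain ⟨q1, q2⟩ := bp_bounds hΔ hD (flip i μ) (s n h)
    have hf := bp_flip (Δ := Δ) i μ (s n h)
    simp only [lik, if_true, Bool.false_eq_true, if_false]
    set p := bp Δ μ (s n h)
    set q := bp Δ (flip i μ) (s n h)
    set A := lik Δ μ h
    set B := lik Δ (flip i μ) h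
    have e1 : p * A * (q * B) = (p * q) * (A * B) := by ring
    have e2 : (1-p) * A * ((1-q) * B) = ((1-p) * (1-q)) * (A * B) := by ring
    rw [e1, e2, Real.sqrt_mul (x := p*q) (by nlinarith), Real.sqrt_mul (x := (1-p)*(1-q)) (by nlinarith)]
    have a1 := sqrt_aux p1 q1 (by linarith) (by linarith)
    have a2 := sqrt_aux (p := 1-p) (q := 1-q) (by linarith) (by linarith) (by linarith) (by linarith)
    have a3 : 1 - 4 * Δ^2 ≤ √(p*q) + √((1-p)*(1-q)) := by
      have : (1-p-(1-q))^2 = (p-q)^2 := by ring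
      rw [this] at a2
      linarith
    have b : 0 ≤ (1 - 4 * Δ^2)^n * √(A*B) :=
      mul_nonneg (pow_nonneg (by linarith) _) (Real.sqrt_nonneg _)
    have := mul_le_mul_of_nonneg_right a3 b
    calc _ = (1 - 4*Δ^2) * ((1 - 4 * Δ^2)^n * √(A*B)) := by ring
      _ ≤ _ := this
      _ = _ := by ring

lemma mis_nonneg {D : ℕ} (μ : Act D) (i h) : 0 ≤ mis μ i h := by
  induction h with
  | nil => simp [mis]
  | cons x h ih => rw [mis]; split_ifs <;> linarith

lemma misT_nonneg {D : ℕ} (μ : Act D) (h) : 0 ≤ misT μ h :=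
  Finset.sum_nonneg fun i _ => mis_nonneg μ i h

lemma mis_flip {D : ℕ} (μ : Act D) (i h) : mis μ i h + mis (flip i μ) i h = h.length := by
  induction h with
  | nil => simp [mis]
  | cons x h ih =>
    rw [mis, mis, List.length_cons]
    push_cast
    rw [← ih]
    have : (if x.1 i = μ i then (0:ℝ) else 1) + (if x.1 i = flip i μ i then 0 else 1) = 1 := by
      unfold flip
      cases x.1 i <;> cases μ i <;> simp
    linarith

lemma misT_le {D : ℕ} (μ : Act D) (h) : misT μ h ≤ D * h.length := by
  unfold misT
  have : ∀ i ∈ (Finset.univ : Finset (Fin D)), mis μ i h ≤ h.length := by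
    intro i _
    linarith [mis_flip μ i h, mis_nonneg (flip i μ) i h]
  refine (Finset.sum_le_sum this).trans ?_
  simp

lemma min_aux {P Q : ℝ} (hP : 0 ≤ P) (hQ : 0 ≤ Q) :
    (4 * √(P*Q) - P - Q)/3 ≤ min P Q := by
  rw [Real.sqrt_mul hP]
  have h1 := Real.sq_sqrt hP
  have h2 := Real.sq_sqrt hQ
  apply le_min
  · nlinarith [sq_nonneg (2 * √P - √Q)]
  · nlinarith [sq_nonneg (2 * √Q - √P)]

lemma pair_bound {D : ℕ} {Δ : ℝ} (hΔ : 0 ≤ Δ) (hD : D * Δ ≤ 1/12) (i : Fin D)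
    (h : List (Act D × Bool)) :
    ∑ μ : Act D, (h.length / 6 : ℝ) *
        (4 * √(lik Δ μ h * lik Δ (flip i μ) h) - lik Δ μ h - lik Δ (flip i μ) h)
      ≤ ∑ μ : Act D, lik Δ μ h * mis μ i h := by
  have e : ∑ μ : Act D, lik Δ (flip i μ) h * mis (flip i μ) i h
      = ∑ μ : Act D, lik Δ μ h * mis μ i h :=
    Equiv.sum_comp (Function.Involutive.toPerm (flip i) (flip_flip i))
      (fun μ => lik Δ μ h * mis μ i h)
  have e2 : ∑ μ : Act D, lik Δ μ h * mis μ i h =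
      ∑ μ : Act D, (lik Δ μ h * mis μ i h + lik Δ (flip i μ) h * mis (flip i μ) i h) / 2 := by
    rw [← Finset.sum_div, Finset.sum_add_distrib, e]; ring
  rw [e2]
  apply Finset.sum_le_sum
  intro μ _
  have hP := lik_nonneg hΔ hD μ h
  have hQ := lik_nonneg hΔ hD (flip i μ) h
  have hm := min_aux hP hQ
  have m1 := mis_nonneg μ i h
  have m2 := mis_nonneg (flip i μ) i h
  have ms := mis_flip μ i h
  have a1 := mul_le_mul_of_nonneg_right (hm.trans (min_le_left _ _)) m1
  have a2 := mul_le_mul_of_nonneg_right (hm.trans (min_le_right _ _)) m2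
  rw [← ms]
  nlinarith

/-- Averaged failure likelihood for one instance. -/
noncomputable def gfail {D : ℕ} (Δ t : ℝ) (h : List (Act D × Bool)) : ℝ :=
  (1 / 2 ^ D) * ∑ μ : Act D, if misT μ h < t then lik Δ μ h else 0

lemma gfail_nonneg {D : ℕ} {Δ : ℝ} (hΔ : 0 ≤ Δ) (hD : D * Δ ≤ 1/12) (t) (h : List (Act D × Bool)) :
    0 ≤ gfail Δ t h := by
  unfold gfail
  apply mul_nonneg (by positivity)
  apply Finset.sum_nonneg
  intro μ _
  split_ifs
  · exact lik_nonneg hΔ hD μ h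
  · exact le_rfl

lemma gfail_le {D N : ℕ} {Δ : ℝ} (hΔ : 0 ≤ Δ) (hD : D * Δ ≤ 1/12) (hD0 : 0 < D) (hN : 0 < N)
    (h : List (Act D × Bool)) (hl : h.length = N) :
    gfail Δ (D * N / 10) h ≤ (1 / 2 ^ D) * ∑ μ : Act D, (11/10 * lik Δ μ h + ∑ i : Fin D,
      (-(1 / (6 * D) : ℝ)) *
        (4 * √(lik Δ μ h * lik Δ (flip i μ) h) + ((-1) * lik Δ μ h + (-1) * lik Δ (flip i μ) h))) := by
  unfold gfail
  apply mul_le_mul_of_nonneg_left _ (by positivity)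
  have hDr : (0:ℝ) < D := by exact_mod_cast hD0
  have hNr : (0:ℝ) < N := by exact_mod_cast hN
  have s1 : ∑ μ : Act D, (if misT μ h < D * N / 10 then lik Δ μ h else 0) ≤
      ∑ μ : Act D, (11/10 * lik Δ μ h - (1/(D*N)) * (lik Δ μ h * misT μ h)) := by
    apply Finset.sum_le_sum
    intro μ _
    have hP := lik_nonneg hΔ hD μ h
    have hm := misT_le μ h
    rw [hl] at hm
    have e : 11/10 * lik Δ μ h - (1/(D*N)) * (lik Δ μ h * misT μ h)
        = lik Δ μ h * (11/10 - misT μ h / (D*N)) := by ring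
    rw [e]
    split_ifs with hc
    · have : misT μ h / (D*N) ≤ 1/10 := by
        rw [div_le_iff₀ (by positivity)]; linarith
      nlinarith
    · have : misT μ h / (D*N) ≤ 1 := by
        rw [div_le_iff₀ (by positivity)]; linarith
      apply mul_nonneg hP; linarith
  refine s1.trans ?_
  rw [Finset.sum_sub_distrib, Finset.sum_add_distrib, sub_eq_add_neg]
  apply add_le_add le_rfl
  rw [← Finset.mul_sum]
  have s2 : ∑ μ : Act D, lik Δ μ h * misT μ h = ∑ i, ∑ μ : Act D, lik Δ μ h * mis μ i h := by
    rw [Finset.sum_comm]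
    apply Finset.sum_congr rfl; intro μ _
    rw [misT, Finset.mul_sum]
  conv_rhs => rw [Finset.sum_comm]
  rw [s2, Finset.mul_sum, ← Finset.sum_neg_distrib]
  apply Finset.sum_le_sum
  intro i _
  have := pair_bound hΔ hD i h
  rw [hl, ← Finset.mul_sum] at this
  rw [← Finset.mul_sum]
  have e3 : ∑ μ : Act D, (4 * √(lik Δ μ h * lik Δ (flip i μ) h) + ((-1) * lik Δ μ h + (-1) * lik Δ (flip i μ) h))
     = ∑ μ : Act D, (4 * √(lik Δ μ h * lik Δ (flip i μ) h) - lik Δ μ h - lik Δ (flip i μ) h) := by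
    apply Finset.sum_congr rfl; intro μ _; ring
  rw [e3]
  have h2 := mul_le_mul_of_nonneg_left this (show (0:ℝ) ≤ 1/(D*N) by positivity)
  have h3 : (1:ℝ)/(D*N) * (N/6 * ∑ μ : Act D, (4 * √(lik Δ μ h * lik Δ (flip i μ) h) - lik Δ μ h - lik Δ (flip i μ) h)) = (1/(6*D)) * ∑ μ : Act D, (4 * √(lik Δ μ h * lik Δ (flip i μ) h) - lik Δ μ h - lik Δ (flip i μ) h) := by
    field_simp
  rw [h3] at h2
  linarith

lemma V_gfail {D N : ℕ} {Δ : ℝ} (hΔ : 0 ≤ Δ) (hD : D * Δ ≤ 1/12) (hD0 : 0 < D) (hN : 0 < N)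
    (hΔN : 96 * N * Δ^2 = 1) :
    V N (gfail (D := D) Δ (D * N / 10)) [] ≤ 9/10 := by
  obtain ⟨s, hs⟩ := exists_strategy (gfail (D := D) Δ (D * N / 10))
  rw [← hs]
  refine (W_mono s N _ _ [] (fun h hl => gfail_le hΔ hD hD0 hN h (by simpa using hl))).trans ?_
  have hDr : (0:ℝ) < D := by exact_mod_cast hD0
  have hNr : (1:ℝ) ≤ N := by exact_mod_cast hN
  have h4 : 4 * Δ^2 ≤ 1 := by nlinarith [sq_nonneg Δ]
  rw [W_smul, W_sum]
  have key : ∀ μ : Act D, W s N (fun h => 11/10 * lik Δ μ h + ∑ i : Fin D,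
      (-(1 / (6 * D) : ℝ)) *
        (4 * √(lik Δ μ h * lik Δ (flip i μ) h) + ((-1) * lik Δ μ h + (-1) * lik Δ (flip i μ) h))) []
        ≤ 9/10 := by
    intro μ
    rw [W_add, W_smul, W_sum, W_lik]
    have hi : ∀ i ∈ (Finset.univ : Finset (Fin D)), W s N (fun h => (-(1 / (6 * D) : ℝ)) *
        (4 * √(lik Δ μ h * lik Δ (flip i μ) h) + ((-1) * lik Δ μ h + (-1) * lik Δ (flip i μ) h))) []
        ≤ - (1/(6*D)) * (11/6) := by
      intro i _
      rw [W_smul, W_add, W_add, W_smul, W_smul, W_smul, W_lik, W_lik]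
      have ha := W_aff hΔ hD h4 s i μ N []
      have hb := one_add_mul_le_pow (a := -(4*Δ^2)) (by linarith) N
      rw [← sub_eq_add_neg] at hb
      simp only [lik, mul_one, Real.sqrt_one] at ha ⊢
      have hc : (0:ℝ) ≤ 1/(6*D) := by positivity
      nlinarith
    refine (add_le_add le_rfl (Finset.sum_le_sum hi)).trans ?_
    simp [lik]
    have : (D:ℝ) * ((D:ℝ)⁻¹ * 6⁻¹ * (11/6)) = 11/36 := by field_simp; norm_num
    rw [this]; norm_num
  refine (mul_le_mul_of_nonneg_left (Finset.sum_le_sum (fun μ _ => key μ)) (by positivity)).trans ?_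
  simp

/-! ### Combined instance -/

lemma hist_congr {D : ℕ} (π : Alg D) (σ : ℝ) {ω ω' : ℕ → Bool} (k : ℕ)
    (h : ∀ j < k, ω j = ω' j) : hist π σ ω k = hist π σ ω' k := by
  induction k with
  | zero => rfl
  | succ k ih =>
    rw [hist, hist, ih (fun j hj => h j (by omega)), h k (by omega)]

/-- Per-instance (reversed) histories. -/
noncomputable def Hs {D L : ℕ} (hL : 0 < L) (π : Alg D) (σ : ℝ) (ω : ℕ → Bool) :
    ℕ → Fin L → List (Act D × Bool)
  | 0 => fun _ => []
  | k + 1 => Function.update (Hs hL π σ ω k) ⟨k % L, Nat.mod_lt _ hL⟩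
      ((act π σ ω k, ω k) :: Hs hL π σ ω k ⟨k % L, Nat.mod_lt _ hL⟩)

lemma Hs_congr {D L : ℕ} (hL : 0 < L) (π : Alg D) (σ : ℝ) {ω ω' : ℕ → Bool} (k : ℕ)
    (h : ∀ j < k, ω j = ω' j) : Hs hL π σ ω k = Hs hL π σ ω' k := by
  induction k with
  | zero => rfl
  | succ k ih =>
    rw [Hs, Hs, ih (fun j hj => h j (by omega)), h k (by omega), act, act,
      hist_congr π σ k (fun j hj => h j (by omega))]

lemma Hs_length {D L : ℕ} (hL : 0 < L) (π : Alg D) (σ : ℝ) (ω : ℕ → Bool) (k : ℕ) (l : Fin L) :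
    (Hs hL π σ ω k l).length = Nat.count (fun j => j ≡ l [MOD L]) k := by
  induction k with
  | zero => simp [Hs]
  | succ k ih =>
    rw [Hs, Nat.count_succ]
    by_cases hl : l = ⟨k % L, Nat.mod_lt _ hL⟩
    · have : k ≡ l [MOD L] := by rw [hl]; simp [Nat.ModEq]
      rw [if_pos this, ← ih]
      subst hl
      simp
    · have : ¬ k ≡ l [MOD L] := by
        intro h
        apply hl
        ext
        simp only [Nat.ModEq] at h
        rw [Nat.mod_eq_of_lt l.2] at h
        exact h.symm
      rw [if_neg this, ← ih, Function.update_of_ne hl]; rfl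

lemma prod_upd {D L : ℕ} (G : Fin L → List (Act D × Bool) → ℝ) (H : Fin L → List (Act D × Bool))
    (l0 : Fin L) (y) :
    ∏ l, G l (Function.update H l0 y l) = G l0 y * ∏ l ∈ Finset.univ.erase l0, G l (H l) := by
  rw [← Finset.mul_prod_erase _ _ (Finset.mem_univ l0), Function.update_self]
  congr 1
  apply Finset.prod_congr rfl
  intro l hl
  rw [Function.update_of_ne (Finset.ne_of_mem_erase hl)]

lemma sum_upd {D L : ℕ} (G : Fin L → List (Act D × Bool) → ℝ) (H : Fin L → List (Act D × Bool))
    (l0 : Fin L) (y) :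
    ∑ l, G l (Function.update H l0 y l) = G l0 y + ∑ l ∈ Finset.univ.erase l0, G l (H l) := by
  rw [← Finset.add_sum_erase _ _ (Finset.mem_univ l0), Function.update_self]
  congr 1
  apply Finset.sum_congr rfl
  intro l hl
  rw [Function.update_of_ne (Finset.ne_of_mem_erase hl)]

lemma getμ_eq {D L : ℕ} (hL : 0 < L) (μ : Fin L → Act D) (k : ℕ) :
    getμ μ k = μ ⟨k % L, Nat.mod_lt _ hL⟩ := by
  rw [getμ, dif_pos hL]

lemma ext_val {K : ℕ} (ω : Fin K → Bool) (k : Fin K) : ext ω k = ω k := by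
  simp [ext]

lemma trajP_eq {D L K : ℕ} (hL : 0 < L) (Δ σ : ℝ) (π : Alg D) (μ : Fin L → Act D)
    (ω : Fin K → Bool) :
    trajP D L K Δ σ π μ ω = ∏ l, lik Δ (μ l) (Hs hL π σ (ext ω) K l) := by
  have key : ∀ (w : ℕ → Bool) (k : ℕ), ∏ j ∈ Finset.range k,
      (if w j then bp Δ (getμ μ j) (act π σ w j) else 1 - bp Δ (getμ μ j) (act π σ w j))
      = ∏ l, lik Δ (μ l) (Hs hL π σ w k l) := by
    intro w k
    induction k with
    | zero => simp [Hs, lik]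
    | succ k ih =>
      rw [Finset.prod_range_succ, ih, Hs, prod_upd (fun l => lik Δ (μ l)),
        ← Finset.mul_prod_erase _ _ (Finset.mem_univ (⟨k % L, Nat.mod_lt _ hL⟩ : Fin L)),
        getμ_eq hL, lik]
      ring
  rw [← key, ← Fin.prod_univ_eq_prod_range, trajP]
  apply Finset.prod_congr rfl
  intro k _
  rw [ext_val]

lemma gap_ge {D : ℕ} (Δ : ℝ) (μ a : Act D) :
    2 * Δ * ∑ i, (if a i = μ i then (0:ℝ) else 1) ≤ maxRew D Δ μ - ip (wvec Δ μ) (embed a) := by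
  have h : ip (wvec Δ μ) (embed μ) ≤ maxRew D Δ μ :=
    Finset.le_sup' (fun a : Act D => ip (wvec Δ μ) (embed a)) (Finset.mem_univ μ)
  have e : 2 * Δ * ∑ i, (if a i = μ i then (0:ℝ) else 1)
      = ip (wvec Δ μ) (embed μ) - ip (wvec Δ μ) (embed a) := by
    unfold ip
    rw [← Finset.sum_sub_distrib, Finset.mul_sum]
    apply Finset.sum_congr rfl
    intro i _
    unfold wvec embed
    cases a i <;> cases μ i <;> simp <;> ring
  linarith

lemma misT_cons {D : ℕ} (μ : Act D) (x : Act D × Bool) (h) :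
    misT μ (x :: h) = ∑ i, (if x.1 i = μ i then (0:ℝ) else 1) + misT μ h := by
  simp only [misT, mis, Finset.sum_add_distrib]

lemma regret_ge {D L K : ℕ} (hL : 0 < L) (Δ σ : ℝ) (hσ : 0 ≤ σ) (π : Alg D) (μ : Fin L → Act D)
    (ω : Fin K → Bool) :
    2 * σ * Δ * ∑ l, misT (μ l) (Hs hL π σ (ext ω) K l) ≤ regret D L K Δ σ π μ ω := by
  have key : ∀ (w : ℕ → Bool) (k : ℕ), 2 * σ * Δ * ∑ l, misT (μ l) (Hs hL π σ w k l) ≤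
      ∑ j ∈ Finset.range k, σ * (maxRew D Δ (getμ μ j) - ip (wvec Δ (getμ μ j)) (embed (act π σ w j)))
      := by
    intro w k
    induction k with
    | zero => simp [Hs, misT, mis]
    | succ k ih =>
      rw [Finset.sum_range_succ, Hs, sum_upd (fun l => misT (μ l)), misT_cons, add_assoc,
        Finset.add_sum_erase _ (fun l => misT (μ l) (Hs hL π σ w k l)) (Finset.mem_univ _),
        getμ_eq hL]
      have := mul_le_mul_of_nonneg_left
        (gap_ge Δ (μ ⟨k % L, Nat.mod_lt _ hL⟩) (act π σ w k)) hσ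
      dsimp only
      linarith
  refine (key (ext ω) K).trans (le_of_eq ?_)
  rw [← Fin.sum_univ_eq_sum_range
    (fun j => σ * (maxRew D Δ (getμ μ j) - ip (wvec Δ (getμ μ j)) (embed (act π σ (ext ω) j)))), regret]

lemma sum_succ {D L : ℕ} (hL : 0 < L) (π : Alg D) (σ : ℝ) (k : ℕ)
    (F : (Fin L → List (Act D × Bool)) → ℝ) :
    ∑ ω : Fin (k+1) → Bool, F (Hs hL π σ (ext ω) (k+1)) =
    ∑ ω : Fin k → Bool, ∑ b : Bool, F (Function.update (Hs hL π σ (ext ω) k) ⟨k % L, Nat.mod_lt _ hL⟩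
      ((act π σ (ext ω) k, b) :: Hs hL π σ (ext ω) k ⟨k % L, Nat.mod_lt _ hL⟩)) := by
  rw [← Equiv.sum_comp (Fin.snocEquiv (fun _ : Fin (k+1) => Bool)), Fintype.sum_prod_type,
    Finset.sum_comm]
  apply Finset.sum_congr rfl
  intro ω _
  apply Finset.sum_congr rfl
  intro b _
  have hlt : ∀ j < k, ext (Fin.snocEquiv (fun _ : Fin (k+1) => Bool) (b, ω)) j = ext ω j := by
    intro j hj
    simp [ext, Fin.snocEquiv, Fin.snoc, hj, Nat.lt_succ_of_lt hj]
  have hk : ext (Fin.snocEquiv (fun _ : Fin (k+1) => Bool) (b, ω)) k = b := by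
    simp [ext, Fin.snocEquiv, Fin.snoc]
  rw [Hs, hk, Hs_congr hL π σ k hlt, act, act, hist_congr π σ k hlt]

lemma sum_traj {D L : ℕ} (hL : 0 < L) (Δ σ : ℝ) (π : Alg D) (μ : Fin L → Act D) (k : ℕ) :
    ∑ ω : Fin k → Bool, ∏ l, lik Δ (μ l) (Hs hL π σ (ext ω) k l) = 1 := by
  induction k with
  | zero => simp [Hs, lik]
  | succ k ih =>
    rw [sum_succ hL π σ k (fun H => ∏ l, lik Δ (μ l) (H l)), ← ih]
    apply Finset.sum_congr rfl
    intro ω _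
    simp only [prod_upd (fun l => lik Δ (μ l)), Fintype.sum_bool, lik]
    rw [← Finset.mul_prod_erase _ _ (Finset.mem_univ (⟨k % L, Nat.mod_lt _ hL⟩ : Fin L))]
    simp
    ring

lemma decouple {D L N : ℕ} (hL : 0 < L) (σ : ℝ) (π : Alg D)
    (g : List (Act D × Bool) → ℝ) (hg : ∀ h, 0 ≤ g h) (k : ℕ) (hk : k ≤ N * L) :
    ∑ ω : Fin k → Bool, ∏ l, V (N - (Hs hL π σ (ext ω) k l).length) g (Hs hL π σ (ext ω) k l)
      ≤ (V N g []) ^ L := by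
  induction k with
  | zero => simp [Hs]
  | succ k ih =>
    refine le_trans ?_ (ih (by omega))
    rw [sum_succ hL π σ k (fun H => ∏ l, V (N - (H l).length) g (H l))]
    apply Finset.sum_le_sum
    intro ω _
    simp only [prod_upd (fun _ h => V (N - h.length) g h), Fintype.sum_bool]
    rw [← Finset.mul_prod_erase _ _ (Finset.mem_univ (⟨k % L, Nat.mod_lt _ hL⟩ : Fin L)), ← add_mul]
    apply mul_le_mul_of_nonneg_right _ (Finset.prod_nonneg fun l _ => V_nonneg g hg _ _)
    have hlen := Hs_length hL π σ (ext ω) k ⟨k % L, Nat.mod_lt _ hL⟩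
    rw [Nat.count_modEq_card k hL] at hlen
    simp at hlen
    have hlt : k / L < N := Nat.div_lt_of_lt_mul (by rw [mul_comm]; omega)
    set h := Hs hL π σ (ext ω) k ⟨k % L, Nat.mod_lt _ hL⟩
    have e : N - h.length = (N - (h.length + 1)) + 1 := by omega
    rw [e]
    simpa using V_step g _ h (act π σ (ext ω) k)

lemma prob_main {D L N : ℕ} (hL : 0 < L) (hN : 0 < N) (hD0 : 0 < D) {Δ σ t : ℝ} (hΔ : 0 < Δ)
    (hD : D * Δ ≤ 1/12) (hΔN : 96 * N * Δ^2 = 1) (hσ : 0 < σ)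
    (ht : t ≤ 2 * σ * Δ * (D * N / 10)) (π : Alg D) :
    1 - (9/10 : ℝ) ^ L ≤ probRegretGe D L (N * L) Δ σ t π := by
  set K := N * L with hK
  set g : List (Act D × Bool) → ℝ := gfail Δ (D * N / 10) with hgdef
  have hg : ∀ h, 0 ≤ g h := gfail_nonneg hΔ.le hD _
  have hlen : ∀ (ω : Fin K → Bool) (l : Fin L), (Hs hL π σ (ext ω) K l).length = N := by
    intro ω l
    rw [Hs_length, Nat.count_modEq_card K hL, hK]
    simp [hL]
  have hV := V_gfail hΔ.le hD hD0 hN hΔN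
  have hdec := decouple (N := N) hL σ π g hg K le_rfl
  simp only [hlen, Nat.sub_self, V] at hdec
  have h1 : (V N g []) ^ L ≤ (9/10 : ℝ)^L := pow_le_pow_left₀ (V_nonneg g hg _ _) hV L
  -- failure probability
  have hfail : (1 / 2 ^ (D * L) : ℝ) * ∑ μ : Fin L → Act D, ∑ ω : Fin K → Bool,
      (∏ l, if misT (μ l) (Hs hL π σ (ext ω) K l) < D * N / 10
        then lik Δ (μ l) (Hs hL π σ (ext ω) K l) else 0)
      = ∑ ω : Fin K → Bool, ∏ l, g (Hs hL π σ (ext ω) K l) := by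
    rw [Finset.sum_comm, Finset.mul_sum]
    apply Finset.sum_congr rfl
    intro ω _
    rw [hgdef]
    simp only [gfail]
    rw [Finset.prod_mul_distrib, Finset.prod_const, Finset.card_univ, Fintype.card_fin,
      div_pow, one_pow, ← pow_mul, Finset.prod_univ_sum]
    simp
  have htot : (1 / 2 ^ (D * L) : ℝ) * ∑ μ : Fin L → Act D, ∑ ω : Fin K → Bool,
      ∏ l, lik Δ (μ l) (Hs hL π σ (ext ω) K l) = 1 := by
    simp only [sum_traj]
    simp [pow_mul]
  have hle : (1 / 2 ^ (D * L) : ℝ) * ∑ μ : Fin L → Act D, ∑ ω : Fin K → Bool,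
      ∏ l, lik Δ (μ l) (Hs hL π σ (ext ω) K l) ≤ probRegretGe D L K Δ σ t π +
      (1 / 2 ^ (D * L) : ℝ) * ∑ μ : Fin L → Act D, ∑ ω : Fin K → Bool,
      (∏ l, if misT (μ l) (Hs hL π σ (ext ω) K l) < D * N / 10
        then lik Δ (μ l) (Hs hL π σ (ext ω) K l) else 0) := by
    unfold probRegretGe
    rw [← mul_add, ← Finset.sum_add_distrib]
    apply mul_le_mul_of_nonneg_left _ (by positivity)
    apply Finset.sum_le_sum
    intro μ _
    rw [← Finset.sum_add_distrib]
    apply Finset.sum_le_sum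
    intro ω _
    rw [trajP_eq hL]
    split_ifs with hr
    · have : 0 ≤ ∏ l, (if misT (μ l) (Hs hL π σ (ext ω) K l) < D * N / 10
        then lik Δ (μ l) (Hs hL π σ (ext ω) K l) else 0) := by
        apply Finset.prod_nonneg
        intro l _
        split_ifs
        · exact lik_nonneg hΔ.le hD _ _
        · exact le_rfl
      linarith
    · rw [zero_add]
      apply le_of_eq
      apply Finset.prod_congr rfl
      intro l _
      rw [if_pos]
      by_contra hcon
      push Not at hcon hr
      have hreg := regret_ge hL Δ σ hσ.le π μ ω
      have hs := Finset.single_le_sum (f := fun l => misT (μ l) (Hs hL π σ (ext ω) K l))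
        (fun l _ => misT_nonneg _ _) (Finset.mem_univ l)
      have hpos : 0 ≤ 2 * σ * Δ := by positivity
      have := mul_le_mul_of_nonneg_left (hcon.trans hs) hpos
      linarith
  rw [htot, hfail] at hle
  linarith

/-- there are universal constants `c, C > 0` such that for all
`d ≥ 2`, `σ ∈ (0,1]`, `K ≥ 1.5·d²`, with `L = ⌈C·log²(dK)⌉` dividing both `d`
and `K` and `K/L ≥ 1.5·(d/L)²`, the combined instance of `L` independent
orthogonally embedded hypercube instances of dimension `d' = d/L`, horizon
`K' = K/L` and variance level `σ` (weight vectors uniform on `{−Δ',Δ'}^{d'}`,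
`Δ' = 1/√(96·K')`, instance `k mod L` presented in round `k`) satisfies: for
every deterministic algorithm, with probability at least `1 − 1/K³`, the total
pseudo-regret is at least `c·d·√(K·σ²)/log³(dK)`. -/
theorem combined_high_probability_lower_bound :
    ∃ c : ℝ, 0 < c ∧ ∃ C : ℝ, 0 < C ∧
      ∀ (d K : ℕ) (σ : ℝ), 2 ≤ d → 0 < σ → σ ≤ 1 →
        (3 : ℝ) / 2 * (d : ℝ) ^ 2 ≤ (K : ℝ) →
        ∀ L : ℕ, L = ⌈C * (Real.log ((d : ℝ) * (K : ℝ))) ^ 2⌉₊ →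
          L ∣ d → L ∣ K →
          (3 : ℝ) / 2 * (((d / L : ℕ) : ℝ)) ^ 2 ≤ ((K / L : ℕ) : ℝ) →
          ∀ π : Alg (d / L),
            1 - 1 / (K : ℝ) ^ 3 ≤
              probRegretGe (d / L) L K (1 / Real.sqrt (96 * ((K / L : ℕ) : ℝ))) σ
                (c * (d : ℝ) * Real.sqrt ((K : ℝ) * σ ^ 2) /
                  (Real.log ((d : ℝ) * (K : ℝ))) ^ 3) π := by
  refine ⟨1/20000, by norm_num, 30, by norm_num, ?_⟩
  intro d K σ hd hσ _ hdK L hLdef hLd hLK hDN π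
  have hd2 : (2:ℝ) ≤ d := by exact_mod_cast hd
  have hK6 : (6:ℝ) ≤ K := by nlinarith
  have hK0 : (0:ℝ) < K := by linarith
  have hlog1 : 1 ≤ Real.log (d * K) := by
    rw [Real.le_log_iff_exp_le (by positivity)]
    have := Real.exp_one_lt_d9
    nlinarith
  have hlogK : Real.log K ≤ Real.log (d * K) :=
    Real.log_le_log hK0 (by nlinarith)
  have hlogK0 : 0 ≤ Real.log K := Real.log_nonneg (by linarith)
  set ℓ := Real.log ((d:ℝ) * K) with hℓ
  have hLge : 30 * ℓ^2 ≤ L := by rw [hLdef]; exact Nat.le_ceil _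
  have hLle : (L:ℝ) ≤ 36 * ℓ^2 := by
    have := Nat.ceil_lt_add_one (show 0 ≤ 30 * ℓ^2 by positivity)
    rw [← hLdef] at this
    nlinarith
  have hLr : (0:ℝ) < L := by nlinarith
  have hL : 0 < L := by exact_mod_cast hLr
  obtain ⟨D, rfl⟩ := hLd
  obtain ⟨N, rfl⟩ := hLK
  clear hLdef
  revert π
  revert hDN
  rw [Nat.mul_div_cancel_left D hL, Nat.mul_div_cancel_left N hL]
  intro hDN π
  have hD0 : 0 < D := by
    rcases Nat.eq_zero_or_pos D with h | h
    · subst h; simp at hd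
    · exact h
  have hN0 : 0 < N := by
    rcases Nat.eq_zero_or_pos N with h | h
    · subst h; simp at hK0
    · exact h
  have hNr : (0:ℝ) < N := by exact_mod_cast hN0
  have hDr : (0:ℝ) < D := by exact_mod_cast hD0
  have hs0 : 0 < √(96 * (N:ℝ)) := Real.sqrt_pos.2 (by positivity)
  have hsq : √(96 * (N:ℝ))^2 = 96 * N := Real.sq_sqrt (by positivity)
  have hΔN : 96 * (N:ℝ) * (1 / √(96 * (N:ℝ)))^2 = 1 := by
    rw [div_pow, hsq]; field_simp
  have hDΔ : (D:ℝ) * (1 / √(96 * (N:ℝ))) ≤ 1/12 := by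
    have : 12 * (D:ℝ) ≤ √(96 * (N:ℝ)) := by
      apply Real.le_sqrt_of_sq_le
      nlinarith
    rw [mul_one_div, div_le_iff₀ hs0]
    linarith
  have ht : 1/20000 * ((L * D : ℕ) : ℝ) * √(((L * N : ℕ) : ℝ) * σ^2) / ℓ^3 ≤
      2 * σ * (1 / √(96 * (N:ℝ))) * (D * N / 10) := by
    push_cast
    rw [Real.sqrt_mul (by positivity), Real.sqrt_sq hσ.le, Real.sqrt_mul (by positivity),
      Real.sqrt_mul (by positivity)]
    have h1 : √(L:ℝ) ≤ 6 * ℓ := by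
      rw [Real.sqrt_le_left (by positivity)]; nlinarith
    have h2 : √(96:ℝ) ≤ 10 := by
      rw [Real.sqrt_le_left (by positivity)]; norm_num
    have h96 : 0 < √(96:ℝ) := Real.sqrt_pos.2 (by norm_num)
    have hNs : 0 < √(N:ℝ) := Real.sqrt_pos.2 hNr
    have hNN : (N:ℝ) = √(N:ℝ) * √(N:ℝ) := (Real.mul_self_sqrt hNr.le).symm
    have e : 2 * σ * (1 / (√96 * √(N:ℝ))) * (D * N / 10) = σ * D * √(N:ℝ) / (5 * √96) := by
      have hNN2 : √(N:ℝ)^2 = N := Real.sq_sqrt hNr.le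
      field_simp
      rw [hNN2]
      ring
    rw [e]
    have h3 : (L:ℝ) * √(L:ℝ) ≤ 216 * ℓ^3 := by
      calc (L:ℝ) * √(L:ℝ) ≤ (36 * ℓ^2) * (6 * ℓ) := by gcongr
        _ = _ := by ring
    have h4 : σ * D * √(N:ℝ) / 50 ≤ σ * D * √(N:ℝ) / (5 * √96) := by
      apply div_le_div_of_nonneg_left (by positivity) (by positivity); linarith
    refine le_trans ?_ h4
    rw [div_le_iff₀ (by positivity)]
    have hx : 0 ≤ σ * D * √(N:ℝ) := by positivity
    have h5 := mul_le_mul_of_nonneg_left h3 hx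
    have h6 : 0 ≤ σ * D * √(N:ℝ) * ℓ^3 := by positivity
    nlinarith
  have hmain := prob_main hL hN0 hD0 (Δ := 1 / √(96 * (N:ℝ))) (by positivity) hDΔ hΔN hσ ht π
  rw [mul_comm N L] at hmain
  refine le_trans ?_ hmain
  apply sub_le_sub_left
  have e1 : (9/10:ℝ)^L ≤ Real.exp (-(L/10)) := by
    have : (9/10:ℝ) ≤ Real.exp (-(1/10)) := by
      have := Real.add_one_le_exp (-(1/10):ℝ); linarith
    calc (9/10:ℝ)^L ≤ (Real.exp (-(1/10)))^L := by gcongr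
      _ = _ := by rw [← Real.exp_nat_mul]; ring_nf
  refine e1.trans ?_
  have e2 : 1 / ((L * N : ℕ) : ℝ)^3 = Real.exp (-(3 * Real.log ((L * N : ℕ) : ℝ))) := by
    rw [Real.exp_neg, show (3:ℝ) * Real.log ((L * N : ℕ) : ℝ) = ((3:ℕ):ℝ) * Real.log ((L * N : ℕ) : ℝ) by norm_num,
      Real.exp_nat_mul, Real.exp_log hK0, one_div]
  rw [e2]
  apply Real.exp_le_exp.2
  nlinarith

end CombinedHypercube
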